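/- Let X be a finite poset. Assume there exist a maximal connected subset Y of X (maximal in C(X) under inclusion), elements a, b, c, d ∈ Y and n ≥ 1 satisfying: (i) the subposet Y satisfies condition (*_{n−1}); (ii) |min_Y(a) ∪ min_Y(b)| = n; (iii) min_Y(a) = min_Y(b); (iv) min_Y(c) = min_Y(d) = min_Y(a) ∪ min_Y(b); (v) a ≤ c, a ≤ d, b ≤ c, b ≤ d; (vi) there is no e ∈ Y with a ≤ e, b ≤ e, e ≤ c and e ≤ d. Then the preordered class Un(X) of unifiers for X admits no minimal complete set (type 0). -/

import Mathlib

/-- The set of minimal elements of a poset `X` lying below `x`. -/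
def minBelow (X : Type*) [PartialOrder X] (x : X) : Set X :=
  {m | m ≤ x ∧ ∀ z : X, z ≤ m → z = m}

/-- A p-morphism between posets: a monotone map commuting with `minBelow`. -/
def IsPMorphism {X Y : Type*} [PartialOrder X] [PartialOrder Y] (u : X → Y) : Prop :=
  Monotone u ∧ ∀ x : X, u '' minBelow X x = minBelow Y (u x)

/-- Condition `(*)`. -/
def StarCond (X : Type*) [PartialOrder X] : Prop :=
  ∀ x y : X, ∃ z : X, IsLUB {x, y} z ∧ minBelow X z = minBelow X x ∪ minBelow X y

/-- Condition `(*_n)` for `n ≥ 1`. -/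
def StarCondN (n : ℕ) (X : Type*) [PartialOrder X] : Prop :=
  ∀ x y : X, (minBelow X x ∪ minBelow X y).ncard ≤ n →
    ∃ z : X, IsLUB {x, y} z ∧ minBelow X z = minBelow X x ∪ minBelow X y

/-- Condition `(*_n)` with the convention that `(*_0)` means nonempty. -/
def StarCondN' (n : ℕ) (X : Type*) [PartialOrder X] : Prop :=
  if n = 0 then Nonempty X else StarCondN n X

/-- The poset `X` belongs to the class `P^f_n`. -/
def InPfn (n : ℕ) (X : Type*) [PartialOrder X] : Prop :=
  ∀ x : X, (minBelow X x).ncard ≤ n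

/-- `M` is a complete set for the preordered class `(S, le)`. -/
def IsCompleteSet {S : Type*} (le : S → S → Prop) (M : Set S) : Prop :=
  ∀ x : S, ∃ y ∈ M, le x y

/-- `M` is a minimal complete set for the preordered class `(S, le)`. -/
def IsMinimalCompleteSet {S : Type*} (le : S → S → Prop) (M : Set S) : Prop :=
  IsCompleteSet le M ∧ ∀ x ∈ M, ∀ y ∈ M, le x y → x = y

/-- A connected subset of a poset. -/
def IsConnectedSub (X : Type*) [PartialOrder X] (Y : Set X) : Prop :=
  (∀ y ∈ Y, minBelow X y ⊆ Y) ∧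
  ∀ x ∈ Y, ∀ y ∈ Y, ∃ z ∈ Y, x ≤ z ∧ y ≤ z ∧
    minBelow X z = minBelow X x ∪ minBelow X y

/-- An `n`-connected subset of a poset. -/
def IsNConnectedSub (n : ℕ) (X : Type*) [PartialOrder X] (Y : Set X) : Prop :=
  (∀ y ∈ Y, minBelow X y ⊆ Y) ∧
  (∀ S : Set X, S ⊆ (⋃ y ∈ Y, minBelow X y) → S.Nonempty → S.ncard ≤ n →
    ∃ z ∈ Y, minBelow X z = S) ∧
  (∀ x ∈ Y, ∀ y ∈ Y, minBelow X x = minBelow X y → (minBelow X x).ncard < n →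
    ∃ (r : ℕ) (c : ℕ → X), c 0 = x ∧ c r = y ∧ (∀ i ≤ r, c i ∈ Y) ∧
      (∀ i ≤ r, minBelow X (c i) = minBelow X x) ∧
      (∀ i < r, if Even i then c (i + 1) ≤ c i else c i ≤ c (i + 1)))

/-- The special product `X ⊙ Y`. -/
abbrev Odot (X Y : Type*) : Type _ :=
  {p : WithBot X × WithBot Y // p ≠ (⊥, ⊥)}

/-- The subposet `(X)_n` of elements with at most `n` minimal elements below them. -/
abbrev SubPn (n : ℕ) (X : Type*) [PartialOrder X] : Type _ :=
  {x : X // (minBelow X x).ncard ≤ n}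

/-- A unifier for a finite poset `X`: a p-morphism into `X` from a nonempty finite
poset satisfying `(*)`. -/
structure Unifier (X : Type) [PartialOrder X] [Finite X] : Type 1 where
  Y : Type
  [po : PartialOrder Y]
  [fin : Finite Y]
  ne : Nonempty Y
  star : StarCond Y
  u : Y → X
  hu : IsPMorphism u

attribute [instance] Unifier.po Unifier.fin

/-- The "more general" preorder on unifiers: `v ≼ w`. -/
def UnifierLE {X : Type} [PartialOrder X] [Finite X] (v w : Unifier X) : Prop :=
  ∃ ψ : v.Y → w.Y, IsPMorphism ψ ∧ w.u ∘ ψ = v.u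

/-- An `n`-unifier for a finite poset `X` in `P^f_n`. -/
structure UnifierN (n : ℕ) (X : Type) [PartialOrder X] [Finite X] : Type 1 where
  Y : Type
  [po : PartialOrder Y]
  [fin : Finite Y]
  ne : Nonempty Y
  mem : InPfn n Y
  star : StarCondN n Y
  u : Y → X
  hu : IsPMorphism u

attribute [instance] UnifierN.po UnifierN.fin

/-- The "more general" preorder on `n`-unifiers: `v ≼ w`. -/
def UnifierNLE {n : ℕ} {X : Type} [PartialOrder X] [Finite X] (v w : UnifierN n X) : Prop :=
  ∃ ψ : v.Y → w.Y, IsPMorphism ψ ∧ w.u ∘ ψ = v.u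

theorem minBelow_mono {X : Type*} [PartialOrder X] {x y : X} (h : x ≤ y) :
    minBelow X x ⊆ minBelow X y :=
  fun _ hm => ⟨hm.1.trans h, hm.2⟩

theorem minBelow_of_mem {X : Type*} [PartialOrder X] {x m : X} (h : m ∈ minBelow X x) :
    minBelow X m = {m} := by
  ext z
  exact ⟨fun hz => h.2 z hz.1, fun hz => by rw [Set.mem_singleton_iff.1 hz]; exact ⟨le_rfl, h.2⟩⟩

theorem minBelow_nonempty {X : Type*} [PartialOrder X] [Finite X] (x : X) :
    (minBelow X x).Nonempty := by
  obtain ⟨m, hmx, hm⟩ := exists_minimal_le_of_wellFoundedLT (fun _ : X => True) x trivial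
  exact ⟨m, hmx, fun z hz => le_antisymm hz (hm.2 trivial hz)⟩

theorem IsPMorphism.comp {X Y Z : Type*} [PartialOrder X] [PartialOrder Y] [PartialOrder Z]
    {g : Y → Z} {f : X → Y} (hg : IsPMorphism g) (hf : IsPMorphism f) : IsPMorphism (g ∘ f) :=
  ⟨hg.1.comp hf.1, fun x => by rw [Set.image_comp, hf.2, hg.2]; rfl⟩

theorem UnifierLE.trans {X : Type} [PartialOrder X] [Finite X] {u v w : Unifier X}
    (h : UnifierLE u v) (h' : UnifierLE v w) : UnifierLE u w := by
  obtain ⟨f, hf, hf'⟩ := h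
  obtain ⟨g, hg, hg'⟩ := h'
  exact ⟨g ∘ f, hg.comp hf, by rw [← Function.comp_assoc, hg', hf']⟩

theorem UnifierLE.range_subset {X : Type} [PartialOrder X] [Finite X] {v w : Unifier X}
    (h : UnifierLE v w) : Set.range v.u ⊆ Set.range w.u := by
  obtain ⟨f, -, hf⟩ := h
  rw [← hf]
  exact Set.range_comp_subset_range _ _

theorem Unifier.isConnectedSub_range {X : Type} [PartialOrder X] [Finite X] (v : Unifier X) :
    IsConnectedSub X (Set.range v.u) := by
  constructor
  · rintro _ ⟨z, rfl⟩
    rw [← v.hu.2]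
    exact Set.image_subset_range _ _
  · rintro _ ⟨x, rfl⟩ _ ⟨y, rfl⟩
    obtain ⟨z, hz, hmin⟩ := v.star x y
    refine ⟨v.u z, ⟨z, rfl⟩, v.hu.1 (hz.1 (by simp)), v.hu.1 (hz.1 (by simp)), ?_⟩
    rw [← v.hu.2, ← v.hu.2, ← v.hu.2, hmin, Set.image_union]

/-- A unifier above which there is no maximal one excludes minimal complete sets. -/
theorem not_exists_isMinimalCompleteSet {S : Type*} {le : S → S → Prop}
    (htrans : ∀ {x y z}, le x y → le y z → le x z) (s : S)
    (h : ∀ x, le s x → ∃ y, le x y ∧ ¬ le y x) : ¬ ∃ M : Set S, IsMinimalCompleteSet le M := by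
  rintro ⟨M, hM, hmin⟩
  obtain ⟨x, hx, hsx⟩ := hM s
  obtain ⟨y, hxy, hyx⟩ := h x hsx
  obtain ⟨z, hz, hyz⟩ := hM y
  obtain rfl := hmin x hx z hz (htrans hxy hyz)
  exact hyx hyz

theorem IsConnectedSub.exists_upper {X : Type*} [PartialOrder X] [Finite X] {W : Set X}
    (hW : IsConnectedSub X W) {s : X} (hs : s ∈ W) :
    ∃ t ∈ W, minBelow X t = minBelow X s ∧ ∀ w ∈ W, minBelow X w ⊆ minBelow X s → w ≤ t := by
  have key : ∀ F : Set X, F.Finite → F ⊆ {w ∈ W | minBelow X w ⊆ minBelow X s} →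
      ∃ t ∈ W, minBelow X t = minBelow X s ∧ ∀ w ∈ F, w ≤ t := by
    intro F hF
    induction F, hF using Set.Finite.induction_on with
    | empty => exact fun _ => ⟨s, hs, rfl, by simp⟩
    | @insert x F _ _ ih =>
      intro hsub
      obtain ⟨hx, hF⟩ := Set.insert_subset_iff.1 hsub
      obtain ⟨t, ht, hmin, hle⟩ := ih hF
      obtain ⟨z, hz, hxz, htz, hzmin⟩ := hW.2 x hx.1 t ht
      refine ⟨z, hz, by rw [hzmin, hmin, Set.union_eq_right.2 hx.2], ?_⟩
      rintro w (rfl | hw)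
      · exact hxz
      · exact (hle w hw).trans htz
  obtain ⟨t, ht, hmin, hle⟩ := key _ (Set.toFinite _) subset_rfl
  exact ⟨t, ht, hmin, fun w hw hws => hle w ⟨hw, hws⟩⟩

/-- A canonical monotone choice of upper bounds in a connected set. -/
theorem IsConnectedSub.exists_top_fun {X : Type*} [PartialOrder X] [Finite X] [Nonempty X]
    {W : Set X} (hW : IsConnectedSub X W) :
    ∃ t : Set X → X, ∀ x ∈ W, ∀ y ∈ W, t (minBelow X x ∪ minBelow X y) ∈ W ∧
      minBelow X (t (minBelow X x ∪ minBelow X y)) = minBelow X x ∪ minBelow X y ∧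
      ∀ w ∈ W, minBelow X w ⊆ minBelow X x ∪ minBelow X y →
        w ≤ t (minBelow X x ∪ minBelow X y) := by
  have : ∀ S : Set X, ∃ t : X, ∀ x ∈ W, ∀ y ∈ W, S = minBelow X x ∪ minBelow X y →
      t ∈ W ∧ minBelow X t = S ∧ ∀ w ∈ W, minBelow X w ⊆ S → w ≤ t := by
    intro S
    by_cases h : ∃ s ∈ W, minBelow X s = S
    · obtain ⟨s, hs, rfl⟩ := h
      obtain ⟨t, ht⟩ := hW.exists_upper hs
      exact ⟨t, fun _ _ _ _ _ => ht⟩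
    · refine ⟨Classical.arbitrary X, fun x hx y hy hS => (h ?_).elim⟩
      obtain ⟨z, hz, -, -, hmin⟩ := hW.2 x hx y hy
      exact ⟨z, hz, hmin.trans hS.symm⟩
  choose t ht using this
  exact ⟨t, fun x hx y hy => ht _ x hx y hy rfl⟩

/-- The minimal elements of `Z` lying below an element of `WithBot Z`. -/
def botMinBelow {Z : Type*} [PartialOrder Z] (x : WithBot Z) : Set Z :=
  {m | (m : WithBot Z) ≤ x ∧ ∀ z : Z, z ≤ m → z = m}

@[simp] theorem botMinBelow_bot {Z : Type*} [PartialOrder Z] :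
    botMinBelow (⊥ : WithBot Z) = ∅ := by
  ext m; simp [botMinBelow]

@[simp] theorem botMinBelow_coe {Z : Type*} [PartialOrder Z] (z : Z) :
    botMinBelow (z : WithBot Z) = minBelow Z z := by
  ext m; simp [botMinBelow, minBelow]

theorem StarCond.exists_isLUB_withBot {Z : Type*} [PartialOrder Z] (h : StarCond Z)
    (x y : WithBot Z) :
    ∃ z, IsLUB {x, y} z ∧ botMinBelow z = botMinBelow x ∪ botMinBelow y := by
  induction x using WithBot.recBotCoe with
  | bot => exact ⟨y, by simp [isLUB_iff_le_iff, upperBounds], by simp⟩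
  | coe x =>
    induction y using WithBot.recBotCoe with
    | bot => exact ⟨x, by simp [isLUB_iff_le_iff, upperBounds], by simp⟩
    | coe y =>
      obtain ⟨z, hz, hmin⟩ := h x y
      refine ⟨z, ⟨?_, ?_⟩, by simpa using hmin⟩
      · rintro _ (rfl | rfl)
        · exact WithBot.coe_le_coe.2 (hz.1 (by simp))
        · exact WithBot.coe_le_coe.2 (hz.1 (by simp))
      · intro w hw
        have hx : (x : WithBot Z) ≤ w := hw (by simp)
        have hy : (y : WithBot Z) ≤ w := hw (by simp)
        induction w using WithBot.recBotCoe with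
        | bot => simp at hx
        | coe w =>
          refine WithBot.coe_le_coe.2 (hz.2 ?_)
          rintro _ (rfl | rfl)
          · exact WithBot.coe_le_coe.1 hx
          · exact WithBot.coe_le_coe.1 hy

section Odot

variable {Z U : Type*} [PartialOrder Z] [PartialOrder U]

/-- The embedding of the first factor into the special product. -/
def odotInl (z : Z) : Odot Z U := ⟨(z, ⊥), by simp⟩

/-- The embedding of the second factor into the special product. -/
def odotInr (u : U) : Odot Z U := ⟨(⊥, u), by simp⟩

theorem odot_isMin_iff (p : Odot Z U) : (∀ q : Odot Z U, q ≤ p → q = p) ↔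
    (∃ z : Z, (∀ w : Z, w ≤ z → w = z) ∧ odotInl z = p) ∨
      ∃ u : U, (∀ w : U, w ≤ u → w = u) ∧ odotInr u = p := by
  constructor
  · obtain ⟨⟨x, y⟩, hp⟩ := p
    intro h
    induction x using WithBot.recBotCoe with
    | bot =>
      induction y using WithBot.recBotCoe with
      | bot => simp at hp
      | coe u =>
        refine Or.inr ⟨u, fun w hw => ?_, rfl⟩
        have := h (odotInr w) ⟨le_rfl, WithBot.coe_le_coe.2 hw⟩
        simpa [odotInr] using this
    | coe z =>
      have hy := h (odotInl z) ⟨le_rfl, bot_le⟩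
      refine Or.inl ⟨z, fun w hw => ?_, hy⟩
      have := h (odotInl w) ⟨WithBot.coe_le_coe.2 hw, bot_le⟩
      have := congrArg (fun q => q.1.1) this
      simpa [odotInl] using this
  · rintro (⟨z, hz, rfl⟩ | ⟨u, hu, rfl⟩) ⟨⟨x, y⟩, hq⟩ ⟨hx, hy⟩
    · obtain rfl : y = ⊥ := le_bot_iff.1 hy
      induction x using WithBot.recBotCoe with
      | bot => simp at hq
      | coe x =>
        obtain rfl := hz x (WithBot.coe_le_coe.1 hx)
        rfl
    · obtain rfl : x = ⊥ := le_bot_iff.1 hx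
      induction y using WithBot.recBotCoe with
      | bot => simp at hq
      | coe y =>
        obtain rfl := hu y (WithBot.coe_le_coe.1 hy)
        rfl

theorem minBelow_odot (p : Odot Z U) : minBelow (Odot Z U) p =
    odotInl '' botMinBelow p.1.1 ∪ odotInr '' botMinBelow p.1.2 := by
  ext m
  constructor
  · rintro ⟨hm, hmin⟩
    rcases (odot_isMin_iff m).1 hmin with ⟨z, hz, rfl⟩ | ⟨u, hu, rfl⟩
    · exact Or.inl ⟨z, ⟨hm.1, hz⟩, rfl⟩
    · exact Or.inr ⟨u, ⟨hm.2, hu⟩, rfl⟩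
  · rintro (⟨z, ⟨hzp, hz⟩, rfl⟩ | ⟨u, ⟨hup, hu⟩, rfl⟩)
    · exact ⟨⟨hzp, bot_le⟩, (odot_isMin_iff _).2 (Or.inl ⟨z, hz, rfl⟩)⟩
    · exact ⟨⟨bot_le, hup⟩, (odot_isMin_iff _).2 (Or.inr ⟨u, hu, rfl⟩)⟩

theorem isPMorphism_odotInl : IsPMorphism (odotInl : Z → Odot Z U) :=
  ⟨fun _ _ h => ⟨WithBot.coe_le_coe.2 h, le_rfl⟩, fun z => by
    rw [minBelow_odot]; simp [odotInl]⟩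

theorem isPMorphism_odotInr : IsPMorphism (odotInr : U → Odot Z U) :=
  ⟨fun _ _ h => ⟨le_rfl, WithBot.coe_le_coe.2 h⟩, fun z => by
    rw [minBelow_odot]; simp [odotInr]⟩

theorem starCond_odot (hZ : StarCond Z) (hU : StarCond U) : StarCond (Odot Z U) := by
  rintro ⟨⟨x, y⟩, hp⟩ ⟨⟨x', y'⟩, hp'⟩
  obtain ⟨z, hz, hzmin⟩ := hZ.exists_isLUB_withBot x x'
  obtain ⟨u, hu, humin⟩ := hU.exists_isLUB_withBot y y'
  have hxz : x ≤ z := hz.1 (by simp)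
  have hyu : y ≤ u := hu.1 (by simp)
  refine ⟨⟨(z, u), ?_⟩, ⟨?_, ?_⟩, ?_⟩
  · rintro h
    simp only [Prod.mk.injEq] at h
    obtain ⟨rfl, rfl⟩ := h
    rw [le_bot_iff] at hxz hyu
    exact hp (by rw [hxz, hyu])
  · rintro _ (rfl | rfl)
    · exact ⟨hxz, hyu⟩
    · exact ⟨hz.1 (by simp), hu.1 (by simp)⟩
  · rintro ⟨⟨w, w'⟩, hw0⟩ hw
    have h1 := hw (Set.mem_insert _ _)
    have h2 := hw (Set.mem_insert_of_mem _ rfl)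
    refine ⟨hz.2 ?_, hu.2 ?_⟩
    · rintro _ (rfl | rfl)
      · exact h1.1
      · exact h2.1
    · rintro _ (rfl | rfl)
      · exact h1.2
      · exact h2.2
  · simp only [minBelow_odot, hzmin, humin, Set.image_union]
    ac_rfl

/-- The map on the special product given by maps on the factors and a map on pairs. -/
def odotMap {X : Type*} [Inhabited X] (f : Z → X) (g : U → X) (k : Z → U → X)
    (p : Odot Z U) : X :=
  WithBot.recBotCoe (C := fun _ => X) (WithBot.recBotCoe (C := fun _ => X) default g p.1.2)
    (fun z => WithBot.recBotCoe (C := fun _ => X) (f z) (k z) p.1.2) p.1.1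

theorem isPMorphism_odotMap {X : Type*} [PartialOrder X] [Inhabited X] {f : Z → X} {g : U → X}
    {k : Z → U → X} (hf : IsPMorphism f) (hg : IsPMorphism g)
    (hk : ∀ z z' u u', z ≤ z' → u ≤ u' → k z u ≤ k z' u')
    (hfk : ∀ z u, f z ≤ k z u) (hgk : ∀ z u, g u ≤ k z u)
    (hmin : ∀ z u, minBelow X (k z u) = minBelow X (f z) ∪ minBelow X (g u)) :
    IsPMorphism (odotMap f g k) := by
  have hl : ∀ z, odotMap f g k (odotInl z) = f z := fun _ => rfl
  have hr : ∀ u, odotMap f g k (odotInr u) = g u := fun _ => rfl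
  constructor
  · rintro ⟨⟨x, y⟩, hp⟩ ⟨⟨x', y'⟩, hp'⟩ ⟨hx, hy⟩
    induction x using WithBot.recBotCoe <;> induction y using WithBot.recBotCoe <;>
      induction x' using WithBot.recBotCoe <;> induction y' using WithBot.recBotCoe <;>
      simp only [odotMap, WithBot.recBotCoe_bot, WithBot.recBotCoe_coe, WithBot.coe_le_coe,
        le_bot_iff, WithBot.coe_ne_bot, ne_eq, not_true_eq_false] at hp hp' hx hy ⊢
    · exact hg.1 hy
    · exact (hg.1 hy).trans (hgk _ _)
    · exact hf.1 hx
    · exact (hf.1 hx).trans (hfk _ _)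
    · exact hk _ _ _ _ hx hy
  · rintro ⟨⟨x, y⟩, hp⟩
    rw [minBelow_odot, Set.image_union, Set.image_image, Set.image_image]
    simp only [hl, hr]
    induction x using WithBot.recBotCoe <;> induction y using WithBot.recBotCoe
    · exact (hp rfl).elim
    all_goals simp [odotMap, hf.2, hg.2, hmin]

end Odot

/-- Two unifiers with values in a connected set have a common generalization there. -/
theorem IsConnectedSub.exists_unifier_sup {X : Type} [PartialOrder X] [Finite X] {W : Set X}
    (hW : IsConnectedSub X W) (v w : Unifier X) (hv : Set.range v.u ⊆ W)
    (hw : Set.range w.u ⊆ W) :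
    ∃ s : Unifier X, UnifierLE v s ∧ UnifierLE w s ∧ Set.range s.u ⊆ W := by
  obtain ⟨z₀⟩ := v.ne
  let _ : Inhabited X := ⟨v.u z₀⟩
  obtain ⟨t, ht⟩ := hW.exists_top_fun
  have hv' : ∀ z, v.u z ∈ W := fun z => hv ⟨z, rfl⟩
  have hw' : ∀ z, w.u z ∈ W := fun z => hw ⟨z, rfl⟩
  let k : v.Y → w.Y → X := fun z u => t (minBelow X (v.u z) ∪ minBelow X (w.u u))
  have hk : ∀ z u, k z u ∈ W ∧ minBelow X (k z u) = minBelow X (v.u z) ∪ minBelow X (w.u u) ∧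
      ∀ x ∈ W, minBelow X x ⊆ minBelow X (v.u z) ∪ minBelow X (w.u u) → x ≤ k z u :=
    fun z u => ht _ (hv' z) _ (hw' u)
  have hp : IsPMorphism (odotMap v.u w.u k) := by
    refine isPMorphism_odotMap v.hu w.hu ?_ ?_ ?_ fun z u => (hk z u).2.1
    · intro z z' u u' hz hu
      refine (hk z' u').2.2 _ (hk z u).1 ?_
      rw [(hk z u).2.1]
      exact Set.union_subset_union (minBelow_mono (v.hu.1 hz)) (minBelow_mono (w.hu.1 hu))
    · exact fun z u => (hk z u).2.2 _ (hv' z) Set.subset_union_left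
    · exact fun z u => (hk z u).2.2 _ (hw' u) Set.subset_union_right
  have : Finite (WithBot v.Y) := inferInstanceAs (Finite (Option v.Y))
  have : Finite (WithBot w.Y) := inferInstanceAs (Finite (Option w.Y))
  refine ⟨⟨Odot v.Y w.Y, ⟨odotInl z₀⟩, starCond_odot v.star w.star, odotMap v.u w.u k, hp⟩,
    ⟨odotInl, isPMorphism_odotInl, rfl⟩, ⟨odotInr, isPMorphism_odotInr, rfl⟩, ?_⟩
  rintro _ ⟨⟨⟨x, y⟩, hxy⟩, rfl⟩
  induction x using WithBot.recBotCoe <;> induction y using WithBot.recBotCoe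
  · simp at hxy
  · exact hw' _
  · exact hv' _
  · exact (hk _ _).1

/-- Among the unifiers with values in a connected set, one has the largest range. -/
theorem IsConnectedSub.exists_unifier_max_range {X : Type} [PartialOrder X] [Finite X] {W : Set X}
    (hW : IsConnectedSub X W) (v₀ : Unifier X) (h₀ : Set.range v₀.u ⊆ W) :
    ∃ v : Unifier X, Set.range v.u ⊆ W ∧
      ∀ w : Unifier X, Set.range w.u ⊆ W → Set.range w.u ⊆ Set.range v.u := by
  obtain ⟨R, -, hR⟩ := (Set.toFinite
    {R : Set X | ∃ v : Unifier X, Set.range v.u ⊆ W ∧ Set.range v.u = R}).exists_le_maximal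
    ⟨v₀, h₀, rfl⟩
  obtain ⟨v, hv, rfl⟩ := hR.1
  refine ⟨v, hv, fun w hw => ?_⟩
  obtain ⟨s, hvs, hws, hs⟩ := hW.exists_unifier_sup v w hv hw
  exact hws.range_subset.trans (hR.2 ⟨s, hs, rfl⟩ hvs.range_subset)

/-- The free join semilattice on `Q`: the nonempty subsets of `Q`. -/
abbrev FreeSup (Q : Type*) : Type _ := {S : Set Q // S.Nonempty}

theorem minBelow_freeSup {Q : Type*} (S : FreeSup Q) :
    minBelow (FreeSup Q) S = (fun q => ⟨{q}, Set.singleton_nonempty q⟩) '' S.1 := by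
  ext ⟨T, hT⟩
  constructor
  · rintro ⟨hTS, hmin⟩
    obtain ⟨q, hq⟩ := hT
    exact ⟨q, hTS hq, hmin ⟨{q}, Set.singleton_nonempty q⟩ (Set.singleton_subset_iff.2 hq)⟩
  · rintro ⟨q, hq, h⟩
    obtain rfl : {q} = T := congrArg Subtype.val h
    refine ⟨Set.singleton_subset_iff.2 hq, fun ⟨R, hR⟩ hRq => Subtype.ext ?_⟩
    exact hR.subset_singleton_iff.1 hRq

theorem starCond_freeSup (Q : Type*) : StarCond (FreeSup Q) := by
  rintro ⟨S, hS⟩ ⟨T, hT⟩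
  refine ⟨⟨S ∪ T, hS.inl⟩, ⟨?_, fun R hR => ?_⟩, ?_⟩
  · rintro _ (rfl | rfl)
    · exact Set.subset_union_left
    · exact Set.subset_union_right
  · exact Set.union_subset (hR (Set.mem_insert _ _)) (hR (Set.mem_insert_of_mem _ rfl))
  · simp only [minBelow_freeSup, Set.image_union]

theorem IsConnectedSub.image_minBelow_subtype {X : Type*} [PartialOrder X] [Finite X] {Y : Set X}
    (hY : IsConnectedSub X Y) (y : {y : X // y ∈ Y}) :
    Subtype.val '' minBelow {y : X // y ∈ Y} y = minBelow X y.1 := by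
  ext m
  constructor
  · rintro ⟨m, ⟨hmy, hm⟩, rfl⟩
    obtain ⟨q, hq⟩ := minBelow_nonempty m.1
    have := hm ⟨q, hY.1 _ m.2 hq⟩ hq.1
    obtain rfl : q = m.1 := congrArg Subtype.val this
    exact ⟨hmy, hq.2⟩
  · intro hm
    exact ⟨⟨m, hY.1 _ y.2 hm⟩, ⟨hm.1, fun z hz => Subtype.ext (hm.2 _ hz)⟩, rfl⟩

theorem IsConnectedSub.exists_join {X : Type*} [PartialOrder X] [Finite X] {Y : Set X}
    (hY : IsConnectedSub X Y) {n : ℕ} (h : StarCondN n {y : X // y ∈ Y}) {x y : X}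
    (hx : x ∈ Y) (hy : y ∈ Y) (hn : (minBelow X x ∪ minBelow X y).ncard ≤ n) :
    ∃ z ∈ Y, minBelow X z = minBelow X x ∪ minBelow X y ∧
      ∀ w ∈ Y, x ≤ w → y ≤ w → z ≤ w := by
  rw [← hY.image_minBelow_subtype ⟨x, hx⟩, ← hY.image_minBelow_subtype ⟨y, hy⟩,
    ← Set.image_union] at hn ⊢
  rw [Set.ncard_image_of_injective _ Subtype.val_injective] at hn
  obtain ⟨z, hz, hmin⟩ := h ⟨x, hx⟩ ⟨y, hy⟩ hn
  refine ⟨z, z.2, by rw [← hY.image_minBelow_subtype z, hmin], fun w hw hxw hyw => ?_⟩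
  have : z ≤ ⟨w, hw⟩ := hz.2 (by
    rintro _ (rfl | rfl)
    · exact hxw
    · exact hyw)
  exact this

/-- In a connected set satisfying `(*_n)`, every nonempty set of at most `n` minimal elements
has a join. -/
theorem IsConnectedSub.exists_join_minimal {X : Type*} [PartialOrder X] [Finite X] {Y : Set X}
    (hY : IsConnectedSub X Y) {n : ℕ} (h : StarCondN' n {y : X // y ∈ Y}) {p : X} (hp : p ∈ Y)
    {S : Set X} (hS : S ⊆ minBelow X p) (hne : S.Nonempty) (hn : S.ncard ≤ n) :
    ∃ z ∈ Y, minBelow X z = S ∧ ∀ w ∈ Y, S ⊆ minBelow X w → z ≤ w := by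
  have hn0 : n ≠ 0 := by
    have := (Set.ncard_pos (Set.toFinite S)).2 hne
    omega
  rw [StarCondN', if_neg hn0] at h
  induction S, Set.toFinite S using Set.Finite.induction_on with
  | empty => exact (Set.not_nonempty_empty hne).elim
  | @insert q S _ _ ih =>
    obtain ⟨hq, hS⟩ := Set.insert_subset_iff.1 hS
    have hqY : q ∈ Y := hY.1 _ hp hq
    have hqmin : minBelow X q = {q} := minBelow_of_mem hq
    rcases S.eq_empty_or_nonempty with rfl | hSne
    · exact ⟨q, hqY, by simpa using hqmin, fun w _ hw => (hw (Set.mem_insert _ _)).1⟩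
    · obtain ⟨z, hz, hzmin, hzle⟩ := ih hS hSne
        ((Set.ncard_le_ncard (Set.subset_insert _ _)).trans hn)
      obtain ⟨j, hj, hjmin, hjle⟩ := hY.exists_join h hqY hz
        (by rw [hqmin, hzmin, Set.singleton_union]; exact hn)
      refine ⟨j, hj, by rw [hjmin, hqmin, hzmin, Set.singleton_union], fun w hw hsub => ?_⟩
      exact hjle w hw (hsub (Set.mem_insert _ _)).1
        (hzle w hw ((Set.subset_insert _ _).trans hsub))

section CrossMap

variable {ι X : Type*} [LinearOrder ι]

open scoped Classical in
/-- Sends the pairs `(i, true)`, `(j, false)` with `i < j` to `c` and those with `j < i` to `d`,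
where points labelled `true` and `false` are sent to `a` and `b`; all else goes to `t`. -/
noncomputable def crossMap (a b c d t : X) (I : Set (ι × Bool)) : X :=
  if ∃ i, I ⊆ {(i, true)} then a
  else if ∃ i, I ⊆ {(i, false)} then b
  else if ∃ i j, i < j ∧ I ⊆ {(i, true), (j, false)} then c
  else if ∃ i j, i < j ∧ I ⊆ {(i, false), (j, true)} then d
  else t

theorem crossMap_mem (a b c d t : X) (I : Set (ι × Bool)) :
    crossMap a b c d t I ∈ ({a, b, c, d, t} : Set X) := by
  unfold crossMap
  split_ifs <;> simp

theorem crossMap_true (a b c d t : X) (i : ι) : crossMap a b c d t {(i, true)} = a :=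
  if_pos ⟨i, subset_rfl⟩

theorem crossMap_false (a b c d t : X) (i : ι) : crossMap a b c d t {(i, false)} = b := by
  rw [crossMap, if_neg (by simp), if_pos ⟨i, subset_rfl⟩]

theorem crossMap_true_false (a b c d t : X) {i j : ι} (h : i < j) :
    crossMap a b c d t {(i, true), (j, false)} = c := by
  rw [crossMap, if_neg (by simp), if_neg (by simp),
    if_pos ⟨i, j, h, subset_rfl⟩]

theorem crossMap_false_true (a b c d t : X) {i j : ι} (h : i < j) :
    crossMap a b c d t {(i, false), (j, true)} = d := by
  rw [crossMap, if_neg (by simp), if_neg (by simp),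
    if_neg ?_, if_pos ⟨i, j, h, subset_rfl⟩]
  simp only [Set.insert_subset_iff, Set.singleton_subset_iff, Set.mem_insert_iff,
    Set.mem_singleton_iff, Prod.mk.injEq]
  rintro ⟨i', j', h', h1, h2⟩
  simp only [reduceCtorEq, and_false, and_true, false_or, or_false] at h1 h2
  subst h1 h2
  exact lt_asymm h h'

theorem exists_subset_singleton_of_crossing {I : Set (ι × Bool)} {i j i' j' : ι} (hij : i < j)
    (hij' : i' < j') (h : I ⊆ {(i, true), (j, false)}) (h' : I ⊆ {(i', false), (j', true)}) :
    (∃ k, I ⊆ {(k, true)}) ∨ ∃ k, I ⊆ {(k, false)} := by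
  by_cases hT : (i, true) ∈ I
  · by_cases hF : (j, false) ∈ I
    · have e1 := h' hT
      have e2 := h' hF
      simp only [Set.mem_insert_iff, Set.mem_singleton_iff, Prod.mk.injEq, reduceCtorEq,
        and_false, and_true, false_or, or_false] at e1 e2
      subst e1 e2
      exact (lt_asymm hij hij').elim
    · refine Or.inl ⟨i, fun x hx => (h hx).resolve_right ?_⟩
      rintro rfl
      exact hF hx
  · refine Or.inr ⟨j, fun x hx => (h hx).resolve_left ?_⟩
    rintro rfl
    exact hT hx

theorem crossMap_mono [PartialOrder X] {a b c d t : X} (hac : a ≤ c) (had : a ≤ d) (hbc : b ≤ c)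
    (hbd : b ≤ d) (hct : c ≤ t) (hdt : d ≤ t) {I J : Set (ι × Bool)} (hI : I.Nonempty)
    (h : I ⊆ J) : crossMap a b c d t I ≤ crossMap a b c d t J := by
  by_cases hA : ∃ i, J ⊆ {(i, true)}
  · obtain ⟨i, hi⟩ := hA
    rw [hI.subset_singleton_iff.1 (h.trans hi), (hI.mono h).subset_singleton_iff.1 hi]
  by_cases hB : ∃ i, J ⊆ {(i, false)}
  · obtain ⟨i, hi⟩ := hB
    rw [hI.subset_singleton_iff.1 (h.trans hi), (hI.mono h).subset_singleton_iff.1 hi]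
  by_cases hC : ∃ i j, i < j ∧ J ⊆ {(i, true), (j, false)}
  · obtain ⟨i, j, hij, hJ⟩ := hC
    have hC' : ∃ i j, i < j ∧ I ⊆ {(i, true), (j, false)} := ⟨i, j, hij, h.trans hJ⟩
    have : crossMap a b c d t J = c := by
      rw [crossMap, if_neg hA, if_neg hB, if_pos ⟨i, j, hij, hJ⟩]
    rw [this, crossMap, if_pos hC']
    split_ifs
    exacts [hac, hbc, le_rfl]
  by_cases hD : ∃ i j, i < j ∧ J ⊆ {(i, false), (j, true)}
  · obtain ⟨i, j, hij, hJ⟩ := hD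
    have : crossMap a b c d t J = d := by
      rw [crossMap, if_neg hA, if_neg hB, if_neg hC, if_pos ⟨i, j, hij, hJ⟩]
    rw [this, crossMap]
    split_ifs with hA' hB' hC' hD'
    · exact had
    · exact hbd
    · obtain ⟨i', j', hij', hI'⟩ := hC'
      exact ((exists_subset_singleton_of_crossing hij' hij hI' (h.trans hJ)).elim hA' hB').elim
    · exact le_rfl
    · exact (hD' ⟨i, j, hij, h.trans hJ⟩).elim
  have : crossMap a b c d t J = t := by
    rw [crossMap, if_neg hA, if_neg hB, if_neg hC, if_neg hD]
  rw [this]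
  have hmem := crossMap_mem a b c d t I
  simp only [Set.mem_insert_iff, Set.mem_singleton_iff] at hmem
  rcases hmem with h | h | h | h | h <;> rw [h]
  exacts [hac.trans hct, hbc.trans hct, hct, hdt]

end CrossMap

/-- A unifier containing crossing families over `a` and `b`, any two of which with distinct
indices have a common upper bound over `c` or `d`, according to the order of the indices. -/
theorem IsConnectedSub.exists_cross_unifier {X : Type} [PartialOrder X] [Finite X] {Y : Set X}
    (hY : IsConnectedSub X Y) {a b c d : X} (ha : a ∈ Y) (hb : b ∈ Y) (hc : c ∈ Y) (hd : d ∈ Y)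
    (h : StarCondN' ((minBelow X a).ncard - 1) {y : X // y ∈ Y})
    (hbmin : minBelow X b = minBelow X a) (hcmin : minBelow X c = minBelow X a)
    (hdmin : minBelow X d = minBelow X a) (hac : a ≤ c) (had : a ≤ d) (hbc : b ≤ c) (hbd : b ≤ d)
    (ι : Type) [LinearOrder ι] [Finite ι] [Nonempty ι] :
    ∃ v : Unifier X, Set.range v.u ⊆ Y ∧ ∃ x y : ι → v.Y,
      (∀ i, v.u (x i) = a) ∧ (∀ i, v.u (y i) = b) ∧ ∀ i j, i < j →
        (∃ p, x i ≤ p ∧ y j ≤ p ∧ v.u p = c) ∧ ∃ p, y i ≤ p ∧ x j ≤ p ∧ v.u p = d := by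
  classical
  obtain ⟨t, ht, hct, hdt, htmin⟩ := hY.2 c hc d hd
  rw [hcmin, hdmin, Set.union_self] at htmin
  have hj : ∀ S : Set X, ∃ z : X, S ⊆ minBelow X a → S.Nonempty → S ≠ minBelow X a →
      z ∈ Y ∧ minBelow X z = S ∧ ∀ w ∈ Y, S ⊆ minBelow X w → z ≤ w := by
    intro S
    by_cases hS : S ⊆ minBelow X a ∧ S.Nonempty ∧ S ≠ minBelow X a
    · obtain ⟨hS, hne, hne'⟩ := hS
      have := Set.ncard_lt_ncard (hS.ssubset_of_ne hne') (Set.toFinite _)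
      obtain ⟨z, hz⟩ := hY.exists_join_minimal h ha hS hne (by omega)
      exact ⟨z, fun _ _ _ => hz⟩
    · exact ⟨a, fun h1 h2 h3 => (hS ⟨h1, h2, h3⟩).elim⟩
  choose j hj using hj
  let Q := (minBelow X a × Bool) × (ι × Bool)
  let pr : Set Q → Set X := fun S => (fun q : Q => (q.1.1 : X)) '' S
  have hpr : ∀ S, pr S ⊆ minBelow X a := by
    rintro S _ ⟨q, -, rfl⟩
    exact q.1.1.2
  let g : Set (ι × Bool) → X := crossMap a b c d t
  have hg : ∀ I, g I ∈ Y ∧ minBelow X (g I) = minBelow X a := by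
    intro I
    have := crossMap_mem a b c d t I
    simp only [Set.mem_insert_iff, Set.mem_singleton_iff] at this
    rcases this with h | h | h | h | h <;> simp only [g, h] <;> exact ⟨‹_›, by simp [*]⟩
  let u : FreeSup Q → X := fun S =>
    if hS : ∃ q, S.1 = {q} then (hS.choose.1.1 : X)
    else if pr S.1 = minBelow X a then g (Prod.snd '' S.1) else j (pr S.1)
  have hu_single : ∀ S q, S.1 = {q} → u S = q.1.1 := by
    intro S q hq
    have hS : ∃ q, S.1 = {q} := ⟨q, hq⟩
    have hq' : q = hS.choose := Set.singleton_injective (hq.symm.trans hS.choose_spec)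
    simp only [u, dif_pos hS, ← hq']
  have hu_full : ∀ S : FreeSup Q, (¬ ∃ q, S.1 = {q}) → pr S.1 = minBelow X a →
      u S = g (Prod.snd '' S.1) := fun S h h' => by simp only [u, dif_neg h, if_pos h']
  have hu_join : ∀ S : FreeSup Q, (¬ ∃ q, S.1 = {q}) → pr S.1 ≠ minBelow X a →
      u S = j (pr S.1) := fun S h h' => by simp only [u, dif_neg h, if_neg h']
  have hu : ∀ S, u S ∈ Y ∧ minBelow X (u S) = pr S.1 := by
    intro S
    by_cases hq : ∃ q, S.1 = {q}
    · obtain ⟨q, hq⟩ := hq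
      rw [hu_single S q hq, hq]
      exact ⟨hY.1 a ha q.1.1.2,
        (minBelow_of_mem q.1.1.2).trans (Set.image_singleton (f := fun q : Q => (q.1.1 : X))).symm⟩
    · by_cases hS : pr S.1 = minBelow X a
      · rw [hu_full S hq hS, hS]
        exact hg _
      · rw [hu_join S hq hS]
        have := hj _ (hpr S.1) (S.2.image _) hS
        exact ⟨this.1, this.2.1⟩
  have humono : Monotone u := by
    intro S T hST
    have hsub : S.1 ⊆ T.1 := hST
    have hprsub : pr S.1 ⊆ pr T.1 := Set.image_mono hsub
    by_cases hq : ∃ q, S.1 = {q}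
    · obtain ⟨q, hq⟩ := hq
      have : (q.1.1 : X) ∈ minBelow X (u T) := by
        rw [(hu T).2]
        exact ⟨q, hsub (hq ▸ rfl), rfl⟩
      exact hu_single S q hq ▸ this.1
    · by_cases hS : pr S.1 = minBelow X a
      · have hT : pr T.1 = minBelow X a := (hpr _).antisymm (hS ▸ hprsub)
        have hqT : ¬ ∃ q, T.1 = {q} := fun ⟨q, hqT⟩ =>
          hq ⟨q, S.2.subset_singleton_iff.1 (hqT ▸ hsub)⟩
        rw [hu_full S hq hS, hu_full T hqT hT]
        exact crossMap_mono hac had hbc hbd hct hdt (S.2.image _) (Set.image_mono hsub)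
      · rw [hu_join S hq hS]
        exact (hj _ (hpr S.1) (S.2.image _) hS).2.2 _ (hu T).1 ((hu T).2 ▸ hprsub)
  have hup : IsPMorphism u := by
    refine ⟨humono, fun S => ?_⟩
    rw [(hu S).2, minBelow_freeSup, Set.image_image]
    exact Set.image_congr fun q _ => hu_single _ q rfl
  obtain ⟨m, hm⟩ := minBelow_nonempty a
  have hfull : ∀ I : Set (ι × Bool), I.Nonempty →
      ((Set.univ : Set (minBelow X a × Bool)) ×ˢ I).Nonempty :=
    fun I hI => Set.Nonempty.prod ⟨(⟨m, hm⟩, true), trivial⟩ hI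
  let full : ∀ I : Set (ι × Bool), I.Nonempty → FreeSup Q := fun I hI => ⟨_, hfull I hI⟩
  have hufull : ∀ I hI, u (full I hI) = g I := by
    intro I hI
    have h1 : pr (full I hI).1 = minBelow X a := by
      refine (hpr _).antisymm fun p hp => ?_
      obtain ⟨i, hi⟩ := hI
      exact ⟨((⟨p, hp⟩, true), i), ⟨trivial, hi⟩, rfl⟩
    have h2 : Prod.snd '' (full I hI).1 = I :=
      Set.snd_image_prod ⟨(⟨m, hm⟩, true), Set.mem_univ _⟩ I
    rw [hu_full _ ?_ h1, h2]
    rintro ⟨q, hq⟩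
    obtain ⟨i, hi⟩ := hI
    have key : ∀ r, ((⟨m, hm⟩, r), i) = q := fun r => by
      have : ((⟨m, hm⟩, r), i) ∈ (full I ⟨i, hi⟩).1 := ⟨trivial, hi⟩
      rwa [hq] at this
    simpa using (key true).trans (key false).symm
  have hle : ∀ I hI J hJ, I ⊆ J → full I hI ≤ full J hJ :=
    fun I _ J _ hIJ => Set.prod_mono_right hIJ
  refine ⟨⟨FreeSup Q, ⟨full Set.univ Set.univ_nonempty⟩, starCond_freeSup Q, u, hup⟩, ?_,
    fun i => full {(i, true)} (Set.singleton_nonempty _),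
    fun i => full {(i, false)} (Set.singleton_nonempty _), fun i => ?_, fun i => ?_,
    fun i j hij => ⟨⟨full {(i, true), (j, false)} (Set.insert_nonempty _ _), ?_, ?_, ?_⟩,
      ⟨full {(i, false), (j, true)} (Set.insert_nonempty _ _), ?_, ?_, ?_⟩⟩⟩
  · rintro _ ⟨S, rfl⟩
    exact (hu S).1
  · exact (hufull _ (Set.singleton_nonempty _)).trans (crossMap_true _ _ _ _ _ _)
  · exact (hufull _ (Set.singleton_nonempty _)).trans (crossMap_false _ _ _ _ _ _)
  · exact hle _ (Set.singleton_nonempty _) _ (Set.insert_nonempty _ _) (by simp)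
  · exact hle _ (Set.singleton_nonempty _) _ (Set.insert_nonempty _ _) (by simp)
  · exact (hufull _ (Set.insert_nonempty _ _)).trans (crossMap_true_false _ _ _ _ _ hij)
  · exact hle _ (Set.singleton_nonempty _) _ (Set.insert_nonempty _ _) (by simp)
  · exact hle _ (Set.singleton_nonempty _) _ (Set.insert_nonempty _ _) (by simp)
  · exact (hufull _ (Set.insert_nonempty _ _)).trans (crossMap_false_true _ _ _ _ _ hij)

/-- Lemma (equal min-sets case): the given configuration in a maximal connected
subset forces unification type 0. -/
theorem maximal_connected_equal_config_type_zero (X : Type) [PartialOrder X] [Finite X] (Y : Set X)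
    (hYcon : IsConnectedSub X Y)
    (hYmax : ∀ Z : Set X, IsConnectedSub X Z → Y ⊆ Z → Y = Z)
    (a b c d : X) (ha : a ∈ Y) (hb : b ∈ Y) (hc : c ∈ Y) (hd : d ∈ Y)
    (n : ℕ) (hn : 1 ≤ n)
    (h1 : StarCondN' (n - 1) {y : X // y ∈ Y})
    (h2 : (minBelow X a ∪ minBelow X b).ncard = n)
    (h3 : minBelow X a = minBelow X b)
    (h4c : minBelow X c = minBelow X a ∪ minBelow X b)
    (h4d : minBelow X d = minBelow X a ∪ minBelow X b)
    (h5 : a ≤ c ∧ a ≤ d ∧ b ≤ c ∧ b ≤ d)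
    (h6 : ¬ ∃ e ∈ Y, a ≤ e ∧ b ≤ e ∧ e ≤ c ∧ e ≤ d) :
    ¬ ∃ M : Set (Unifier X), IsMinimalCompleteSet UnifierLE M := by
  obtain ⟨hac, had, hbc, hbd⟩ := h5
  rw [← h3, Set.union_self] at h2 h4c h4d
  subst h2
  have hno : ∀ e, a ≤ e → b ≤ e → e ≤ c → ¬ e ≤ d := by
    intro e hae hbe hec hed
    refine h6 ⟨e, ?_, hae, hbe, hec, hed⟩
    have hmin : minBelow X e = minBelow X c :=
      (minBelow_mono hec).antisymm (h4c ▸ minBelow_mono hae)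
    have hup : ∀ x ∈ Y, ∃ z ∈ Y, e ≤ z ∧ x ≤ z ∧ minBelow X z = minBelow X e ∪ minBelow X x := by
      intro x hx
      obtain ⟨z, hz, hcz, hxz, hzmin⟩ := hYcon.2 c hc x hx
      exact ⟨z, hz, hec.trans hcz, hxz, by rw [hzmin, hmin]⟩
    have hcon : IsConnectedSub X (insert e Y) := by
      constructor
      · rintro y (rfl | hy)
        · exact hmin ▸ (hYcon.1 c hc).trans (Set.subset_insert _ _)
        · exact (hYcon.1 y hy).trans (Set.subset_insert _ _)
      · rintro x (rfl | hx) y (rfl | hy)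
        · exact ⟨_, Set.mem_insert _ _, le_rfl, le_rfl, (Set.union_self _).symm⟩
        · obtain ⟨z, hz, h⟩ := hup y hy
          exact ⟨z, Or.inr hz, h⟩
        · obtain ⟨z, hz, h, h', h''⟩ := hup x hx
          exact ⟨z, Or.inr hz, h', h, h''.trans (Set.union_comm _ _)⟩
        · obtain ⟨z, hz, h⟩ := hYcon.2 x hx y hy
          exact ⟨z, Or.inr hz, h⟩
    rw [hYmax _ hcon (Set.subset_insert _ _)]
    exact Set.mem_insert _ _
  have hcross := hYcon.exists_cross_unifier ha hb hc hd h1 h3.symm h4c h4d hac had hbc hbd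
  obtain ⟨v₁, hv₁, -⟩ := hcross (Fin 1)
  obtain ⟨v₀, -, hv₀⟩ := hYcon.exists_unifier_max_range v₁ hv₁
  refine not_exists_isMinimalCompleteSet UnifierLE.trans v₀ fun v hv => ?_
  obtain ⟨w, hw, x, y, hx, hy, hxy⟩ := hcross (Fin (Nat.card (v.Y × v.Y) + 1))
  obtain ⟨s, hvs, hws, -⟩ := v.isConnectedSub_range.exists_unifier_sup v w subset_rfl
    ((hv₀ w hw).trans hv.range_subset)
  refine ⟨s, hvs, fun hsv => ?_⟩
  obtain ⟨f, hf, hfu⟩ := hws.trans hsv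
  have hfu' : ∀ p, v.u (f p) = w.u p := congrFun hfu
  obtain ⟨i, j, hij, heq⟩ : ∃ i j, i < j ∧ (f (x i), f (y i)) = (f (x j), f (y j)) := by
    have := Fintype.ofFinite (v.Y × v.Y)
    obtain ⟨i, j, hne, heq⟩ := Fintype.exists_ne_map_eq_of_card_lt
      (fun i => (f (x i), f (y i))) (by simp [Nat.card_eq_fintype_card])
    rcases lt_or_gt_of_ne hne with h | h
    · exact ⟨i, j, h, heq⟩
    · exact ⟨j, i, h, heq.symm⟩
  simp only [Prod.mk.injEq] at heq
  obtain ⟨⟨p, hxp, hyp, hp⟩, q, hyq, hxq, hq⟩ := hxy i j hij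
  obtain ⟨e, he, -⟩ := v.star (f (x i)) (f (y i))
  refine hno (v.u e) ?_ ?_ ?_ ?_
  · rw [← hx i, ← hfu']
    exact v.hu.1 (he.1 (by simp))
  · rw [← hy i, ← hfu']
    exact v.hu.1 (he.1 (by simp))
  · rw [← hp, ← hfu']
    refine v.hu.1 (he.2 ?_)
    rintro _ (rfl | rfl)
    · exact hf.1 hxp
    · exact heq.2 ▸ hf.1 hyp
  · rw [← hq, ← hfu']
    refine v.hu.1 (he.2 ?_)
    rintro _ (rfl | rfl)
    · exact heq.1 ▸ hf.1 hxq
    · exact hf.1 hyq
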